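/- arXiv:2011.11303 — 5 statements merged into one kernel-verified Lean document; each statement's English description precedes it below -/
import Mathlib

section
/- Optimal recovery bound for noiseless kernel interpolation: let w ∈ H, let f(z) = ⟪w, φ(z)⟫_H, and let c ∈ ℝ^D have entries c_d = f(z_d). Then for every z ∈ Z, the kernel interpolant s(z) = K_{zZ} K⁻¹ c satisfies |f(z) − s(z)| ≤ P(z) · √(‖w‖²_H − cᵀ K⁻¹ c). -/
open Matrix
open scoped RealInnerProductSpace

/-- The residual of `u` after subtracting the combination of the `e i` whose coefficients are
`K⁻¹` applied to the vector of inner products `⟪e i, u⟫`. If `K` is the invertible Gram matrix of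
`e`, this is the component of `u` orthogonal to the span of `e`. -/
noncomputable def gramResidual {ι H : Type*} [Fintype ι] [DecidableEq ι] [NormedAddCommGroup H]
    [InnerProductSpace ℝ H] (K : Matrix ι ι ℝ) (e : ι → H) (u : H) : H :=
  u - ∑ i, (K⁻¹ *ᵥ fun j => ⟪e j, u⟫) i • e i

section gramResidual

variable {ι H : Type*} [Fintype ι] [DecidableEq ι] [NormedAddCommGroup H] [InnerProductSpace ℝ H]
  {K : Matrix ι ι ℝ} {e : ι → H}

lemma inner_gramResidual_right (u v : H) :
    ⟪v, gramResidual K e u⟫ =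
      ⟪v, u⟫ - (fun i => ⟪e i, v⟫) ⬝ᵥ (K⁻¹ *ᵥ fun j => ⟪e j, u⟫) := by
  simp only [gramResidual, inner_sub_right, inner_sum, inner_smul_right, dotProduct]
  congr 1
  exact Finset.sum_congr rfl fun i _ => by rw [mul_comm, real_inner_comm]

lemma inner_apply_gramResidual (hK : ∀ i j, K i j = ⟪e i, e j⟫) (hu : IsUnit K) (u : H) (i : ι) :
    ⟪e i, gramResidual K e u⟫ = 0 := by
  have hrow : (fun j => ⟪e j, e i⟫) = K i := by
    ext j
    rw [hK, real_inner_comm]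
  have hmul : K *ᵥ (K⁻¹ *ᵥ fun j => ⟪e j, u⟫) = fun j => ⟪e j, u⟫ := by
    rw [mulVec_mulVec, mul_nonsing_inv K ((isUnit_iff_isUnit_det K).mp hu), one_mulVec]
  rw [inner_gramResidual_right, hrow, sub_eq_zero]
  exact (congrFun hmul i).symm

lemma inner_gramResidual_gramResidual (hK : ∀ i j, K i j = ⟪e i, e j⟫) (hu : IsUnit K) (u v : H) :
    ⟪gramResidual K e v, gramResidual K e u⟫ =
      ⟪v, u⟫ - (fun i => ⟪e i, v⟫) ⬝ᵥ (K⁻¹ *ᵥ fun j => ⟪e j, u⟫) := by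
  rw [← inner_gramResidual_right]
  conv_lhs => enter [2]; rw [gramResidual]
  simp [inner_sub_left, sum_inner, inner_smul_left, inner_apply_gramResidual hK hu]

end gramResidual

/-- Optimal recovery bound for noiseless kernel interpolation: with `f(z) = ⟪w, φ z⟫`,
`c_d = f(z_d)` and interpolant `s(z) = K_{zZ} K⁻¹ c`, for every `z ∈ Z`,
`|f(z) − s(z)| ≤ P(z) √(‖w‖² − cᵀ K⁻¹ c)`. -/
theorem optimal_recovery_bound
    {Z : Type*} [Nonempty Z] {H : Type*} [NormedAddCommGroup H]
    [InnerProductSpace ℝ H] (φ : Z → H) {D : ℕ} (z : Fin D → Z)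
    (k : Z → Z → ℝ) (hk : ∀ a b, k a b = ⟪φ a, φ b⟫)
    (K : Matrix (Fin D) (Fin D) ℝ) (hK : ∀ i j, K i j = k (z i) (z j))
    (hKpd : K.PosDef)
    (KZ : Z → Fin D → ℝ) (hKZ : ∀ x d, KZ x d = k (z d) x)
    (P : Z → ℝ) (hP : ∀ x, P x = Real.sqrt (k x x - KZ x ⬝ᵥ (K⁻¹ *ᵥ KZ x)))
    (w : H) (f : Z → ℝ) (hf : ∀ x, f x = ⟪w, φ x⟫)
    (c : Fin D → ℝ) (hc : ∀ d, c d = f (z d))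
    (s : Z → ℝ) (hs : ∀ x, s x = KZ x ⬝ᵥ (K⁻¹ *ᵥ c)) :
    ∀ x : Z, |f x - s x| ≤ P x * Real.sqrt (‖w‖ ^ 2 - c ⬝ᵥ (K⁻¹ *ᵥ c)) := by
  intro x
  have hgram : ∀ i j, K i j = ⟪φ (z i), φ (z j)⟫ := fun i j => by rw [hK, hk]
  have hinner := inner_gramResidual_gramResidual hgram hKpd.isUnit
  have hKZx : KZ x = fun d => ⟪φ (z d), φ x⟫ := funext fun d => by rw [hKZ, hk]
  have hcw : c = fun d => ⟪φ (z d), w⟫ := funext fun d => by rw [hc, hf, real_inner_comm]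
  have herr : f x - s x = ⟪gramResidual K (φ ∘ z) (φ x), gramResidual K (φ ∘ z) w⟫ := by
    rw [hf, hs, hKZx, hcw, real_inner_comm]
    exact (hinner w (φ x)).symm
  have hpow : P x = ‖gramResidual K (φ ∘ z) (φ x)‖ := by
    rw [hP, hk, hKZx, norm_eq_sqrt_real_inner]
    exact congrArg Real.sqrt (hinner (φ x) (φ x)).symm
  have hnorm : Real.sqrt (‖w‖ ^ 2 - c ⬝ᵥ (K⁻¹ *ᵥ c)) = ‖gramResidual K (φ ∘ z) w‖ := by
    rw [hcw, ← real_inner_self_eq_norm_sq, norm_eq_sqrt_real_inner]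
    exact congrArg Real.sqrt (hinner w w).symm
  rw [herr, hpow, hnorm]
  exact abs_real_inner_le_norm _ _
end

section
/- Representer theorem with explicit kernel ridge regression solution: fix λ > 0 and targets y ∈ ℝ^D, and define the regularized empirical risk J(w) = (1/D) Σ_{d=1}^D (⟪w, φ(z_d)⟫_H − y_d)² + λ ‖w‖²_H for w ∈ H. Then w* = Σ_{d=1}^D α_d φ(z_d) with α = (K + DλI)⁻¹ y satisfies J(w*) ≤ J(w) for all w ∈ H, and its associated predictor is ⟪w*, φ(z)⟫_H = K_{zZ} (K + DλI)⁻¹ y for every z ∈ Z. -/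
open Matrix
open scoped RealInnerProductSpace

/-- A combination `∑ i, α i • f i` whose residuals at the data are `-(n * lam) * α i`, where `n` is
the number of data points, minimizes the regularized empirical risk. -/
theorem regularizedRisk_le_of_residual_eq {ι H : Type*} [Fintype ι] [NormedAddCommGroup H]
    [InnerProductSpace ℝ H] (f : ι → H) (y α : ι → ℝ) {lam : ℝ} (hlam : 0 ≤ lam) {u : H}
    (hu : u = ∑ i, α i • f i)
    (hres : ∀ i, ⟪u, f i⟫ - y i = -((Fintype.card ι : ℝ) * lam) * α i) (w : H) :
    (1 / (Fintype.card ι : ℝ)) * ∑ i, (⟪u, f i⟫ - y i) ^ 2 + lam * ‖u‖ ^ 2 ≤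
      (1 / (Fintype.card ι : ℝ)) * ∑ i, (⟪w, f i⟫ - y i) ^ 2 + lam * ‖w‖ ^ 2 := by
  obtain ⟨v, rfl⟩ : ∃ v, w = u + v := ⟨w - u, by abel⟩
  have hinner : ⟪u, v⟫ = ∑ i, α i * ⟪v, f i⟫ := by
    rw [real_inner_comm, hu, inner_sum]
    simp only [real_inner_smul_right]
  have hsum : ∑ i, (⟪u + v, f i⟫ - y i) ^ 2 =
      ∑ i, (⟪u, f i⟫ - y i) ^ 2 - 2 * ((Fintype.card ι : ℝ) * lam) * ⟪u, v⟫ +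
        ∑ i, ⟪v, f i⟫ ^ 2 := by
    rw [hinner, Finset.mul_sum, ← Finset.sum_sub_distrib, ← Finset.sum_add_distrib]
    refine Finset.sum_congr rfl fun i _ => ?_
    rw [inner_add_left]
    linear_combination 2 * ⟪v, f i⟫ * hres i
  have hcancel : (1 / (Fintype.card ι : ℝ)) * (2 * ((Fintype.card ι : ℝ) * lam) * ⟪u, v⟫) =
      2 * lam * ⟪u, v⟫ := by
    rcases isEmpty_or_nonempty ι with _ | _
    · simp [hinner]
    · field_simp
  have hpos : 0 ≤ (1 / (Fintype.card ι : ℝ)) * ∑ i, ⟪v, f i⟫ ^ 2 := by positivity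
  have hpos' : 0 ≤ lam * ‖v‖ ^ 2 := by positivity
  rw [hsum, norm_add_sq_real]
  linarith

/-- Representer theorem with explicit kernel ridge regression solution: for `λ > 0`
and targets `y`, the regularized empirical risk
`J(w) = (1/D) Σ_d (⟪w, φ(z_d)⟫ − y_d)² + λ‖w‖²` is minimized over all of `H` by
`w* = Σ_d α_d φ(z_d)` with `α = (K + DλI)⁻¹ y`, and the associated predictor is
`⟪w*, φ(z)⟫ = K_{zZ} (K + DλI)⁻¹ y` for every `z`. -/
theorem representer_theorem_krr
    {Z : Type*} [Nonempty Z] {H : Type*} [NormedAddCommGroup H]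
    [InnerProductSpace ℝ H] (φ : Z → H) {D : ℕ} (z : Fin D → Z)
    (k : Z → Z → ℝ) (hk : ∀ a b, k a b = ⟪φ a, φ b⟫)
    (K : Matrix (Fin D) (Fin D) ℝ) (hK : ∀ i j, K i j = k (z i) (z j))
    (hKpd : K.PosDef)
    (KZ : Z → Fin D → ℝ) (hKZ : ∀ x d, KZ x d = k (z d) x)
    (lam : ℝ) (hlam : 0 < lam) (y : Fin D → ℝ)
    (J : H → ℝ)
    (hJ : ∀ w, J w = (1 / (D : ℝ)) * ∑ d, (⟪w, φ (z d)⟫ - y d) ^ 2 + lam * ‖w‖ ^ 2)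
    (α : Fin D → ℝ)
    (hα : α = (K + ((D : ℝ) * lam) • (1 : Matrix (Fin D) (Fin D) ℝ))⁻¹ *ᵥ y)
    (wstar : H) (hw : wstar = ∑ d, α d • φ (z d)) :
    (∀ w : H, J wstar ≤ J w) ∧
      ∀ x : Z, ⟪wstar, φ x⟫ =
        KZ x ⬝ᵥ ((K + ((D : ℝ) * lam) • (1 : Matrix (Fin D) (Fin D) ℝ))⁻¹ *ᵥ y) := by
  subst hw
  have hpred (x : Z) : ⟪∑ d, α d • φ (z d), φ x⟫ = KZ x ⬝ᵥ α := by
    simp only [sum_inner, real_inner_smul_left, dotProduct, hKZ, hk, mul_comm]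
  refine ⟨fun w => ?_, fun x => hα ▸ hpred x⟩
  have hunit : IsUnit (K + ((D : ℝ) * lam) • (1 : Matrix (Fin D) (Fin D) ℝ)) :=
    (hKpd.add_posSemidef (PosSemidef.one.smul (by positivity))).isUnit
  have hsolve : (K + ((D : ℝ) * lam) • (1 : Matrix (Fin D) (Fin D) ℝ)) *ᵥ α = y := by
    rw [hα, mulVec_mulVec, mul_nonsing_inv _ ((isUnit_iff_isUnit_det _).1 hunit), one_mulVec]
  have hres (d : Fin D) : ⟪∑ e, α e • φ (z e), φ (z d)⟫ - y d =
      -((Fintype.card (Fin D) : ℝ) * lam) * α d := by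
    have hrow : KZ (z d) = K d := by
      ext e
      rw [hKZ, hK, hk, hk, real_inner_comm]
    have hd := congrFun hsolve d
    rw [add_mulVec, smul_mulVec, one_mulVec, Pi.add_apply, Pi.smul_apply, smul_eq_mul] at hd
    rw [hpred, hrow, ← hd, Fintype.card_fin, mulVec]
    ring
  simpa only [hJ, Fintype.card_fin] using
    regularizedRisk_le_of_residual_eq (fun d => φ (z d)) y α hlam.le rfl hres w
end

section
/- Non-negativity of the square-root argument in the deterministic KRR error bound: let w ∈ H with ‖w‖_H ≤ Γ, let f(z) = ⟪w, φ(z)⟫_H, let δ ∈ ℝ^D satisfy |δ_d| ≤ δ̄_d for all d with δ̄ ∈ ℝ^D_{≥0}, let y ∈ ℝ^D have entries y_d = f(z_d) + δ_d, and let Δ = max{ −εᵀ K⁻¹ ε + 2 yᵀ K⁻¹ ε : ε ∈ ℝ^D, |ε_d| ≤ δ̄_d for all d }. Then Γ² + Δ − yᵀ K⁻¹ y ≥ 0. -/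
open Matrix
open scoped RealInnerProductSpace

/-- The interpolation coefficients `K⁻¹ v` of the samples `v i = ⟪w, x i⟫` at vectors with
invertible Gram matrix `K` give an element of norm at most `‖w‖`. -/
theorem dotProduct_inv_gram_mulVec_le_sq_norm {ι H : Type*} [Fintype ι] [DecidableEq ι]
    [NormedAddCommGroup H] [InnerProductSpace ℝ H] (x : ι → H) (K : Matrix ι ι ℝ)
    (hK : ∀ i j, K i j = ⟪x i, x j⟫) (hdet : IsUnit K.det) (w : H) (v : ι → ℝ)
    (hv : ∀ i, v i = ⟪w, x i⟫) : v ⬝ᵥ (K⁻¹ *ᵥ v) ≤ ‖w‖ ^ 2 := by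
  set a := K⁻¹ *ᵥ v with ha
  have hKa : K *ᵥ a = v := by
    rw [ha, mulVec_mulVec, mul_nonsing_inv K hdet, one_mulVec]
  have hw : ⟪w, ∑ i, a i • x i⟫ = v ⬝ᵥ a := by
    simp only [inner_sum, inner_smul_right, dotProduct, hv, mul_comm]
  have hu : ‖∑ i, a i • x i‖ ^ 2 = v ⬝ᵥ a := by
    rw [← real_inner_self_eq_norm_sq, ← hKa, dotProduct_comm]
    simp only [sum_inner, inner_sum, real_inner_smul_left, real_inner_smul_right, dotProduct,
      mulVec, hK, Finset.mul_sum]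
    exact Finset.sum_congr rfl fun i _ => Finset.sum_congr rfl fun j _ => by
      rw [real_inner_comm]; ring
  have h := norm_sub_sq_real w (∑ i, a i • x i)
  rw [hw, hu] at h
  linarith [sq_nonneg ‖w - ∑ i, a i • x i‖]

/-- Non-negativity of the square-root argument in the deterministic KRR error bound:
with `‖w‖ ≤ Γ`, `f(z) = ⟪w, φ z⟫`, noise `|δ_d| ≤ δ̄_d`, targets `y_d = f(z_d) + δ_d`,
and `Δ = max{ −εᵀK⁻¹ε + 2yᵀK⁻¹ε : |ε| ≤ δ̄ }`, one has `Γ² + Δ − yᵀK⁻¹y ≥ 0`. -/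
theorem krr_sqrt_arg_nonneg
    {Z : Type*} [Nonempty Z] {H : Type*} [NormedAddCommGroup H]
    [InnerProductSpace ℝ H] (φ : Z → H) {D : ℕ} (z : Fin D → Z)
    (K : Matrix (Fin D) (Fin D) ℝ) (hK : ∀ i j, K i j = ⟪φ (z i), φ (z j)⟫)
    (hKpd : K.PosDef)
    (Γ : ℝ) (w : H) (hw : ‖w‖ ≤ Γ)
    (f : Z → ℝ) (hf : ∀ x, f x = ⟪w, φ x⟫)
    (δbar : Fin D → ℝ) (hδbar : ∀ d, 0 ≤ δbar d)
    (δ : Fin D → ℝ) (hδ : ∀ d, |δ d| ≤ δbar d)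
    (y : Fin D → ℝ) (hy : ∀ d, y d = f (z d) + δ d)
    (Δ : ℝ)
    (hΔ : IsGreatest
      ((fun ε : Fin D → ℝ => -(ε ⬝ᵥ (K⁻¹ *ᵥ ε)) + 2 * (y ⬝ᵥ (K⁻¹ *ᵥ ε))) ''
        {ε : Fin D → ℝ | ∀ d, |ε d| ≤ δbar d}) Δ) :
    0 ≤ Γ ^ 2 + Δ - y ⬝ᵥ (K⁻¹ *ᵥ y) := by
  have hΔδ := hΔ.2 (Set.mem_image_of_mem _ hδ)
  have hv := dotProduct_inv_gram_mulVec_le_sq_norm (fun i => φ (z i)) K hK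
    ((isUnit_iff_isUnit_det K).1 hKpd.isUnit) w (y - δ)
    fun i => by rw [Pi.sub_apply, hy, add_sub_cancel_right, hf]
  have hsymm : δ ⬝ᵥ (K⁻¹ *ᵥ y) = y ⬝ᵥ (K⁻¹ *ᵥ δ) := by
    have hT : K⁻¹ᵀ = K⁻¹ := by simpa using hKpd.inv.isHermitian.eq
    rw [dotProduct_mulVec, ← mulVec_transpose, hT, dotProduct_comm]
  have hΓ : ‖w‖ ^ 2 ≤ Γ ^ 2 := pow_le_pow_left₀ (norm_nonneg w) hw 2
  simp only [mulVec_sub, sub_dotProduct, dotProduct_sub, hsymm] at hv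
  linarith
end

section
/- Deterministic finite-sample error bound for kernel ridge regression: let w ∈ H with ‖w‖_H ≤ Γ and let f(z) = ⟪w, φ(z)⟫_H be the unknown ground-truth. Let δ ∈ ℝ^D satisfy |δ_d| ≤ δ̄_d for all d with δ̄ ∈ ℝ^D_{≥0}, let y ∈ ℝ^D have entries y_d = f(z_d) + δ_d, fix a regularization constant λ > 0, and let the KRR model be f̂(z) = K_{zZ} (K + DλI)⁻¹ y. Then for every z ∈ Z, |f̂(z) − f(z)| ≤ P(z) √(Γ² + Δ − yᵀ K⁻¹ y) + δ̄ᵀ |K⁻¹ K_{Zz}| + | yᵀ (K + (1/(Dλ)) K K)⁻¹ K_{Zz} |, where Δ = max{ −εᵀ K⁻¹ ε + 2 yᵀ K⁻¹ ε : ε ∈ ℝ^D, |ε_d| ≤ δ̄_d for all d } and |·| applied to a vector denotes the componentwise absolute value. -/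
open Matrix
open scoped RealInnerProductSpace

/-- The map `u ↦ u - ∑ i, (K⁻¹ *ᵥ b u) i • v i`, where `b u i = ⟪v i, u⟫`, is the orthogonal
projection onto the complement of the span of `v`; this computes inner products of its values. -/
theorem inner_gram_residual {ι H : Type*} [Fintype ι] [DecidableEq ι] [NormedAddCommGroup H]
    [InnerProductSpace ℝ H] (v : ι → H) {K : Matrix ι ι ℝ} (hK : ∀ i j, K i j = ⟪v i, v j⟫)
    (hdet : IsUnit K.det) (u w : H) :
    ⟪u - ∑ i, (K⁻¹ *ᵥ fun j => ⟪v j, u⟫) i • v i, w - ∑ i, (K⁻¹ *ᵥ fun j => ⟪v j, w⟫) i • v i⟫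
      = ⟪u, w⟫ - (fun i => ⟪v i, w⟫) ⬝ᵥ (K⁻¹ *ᵥ fun j => ⟪v j, u⟫) := by
  have inner_comb (c : ι → ℝ) (x : H) :
      ⟪∑ i, c i • v i, x⟫ = (fun i => ⟪v i, x⟫) ⬝ᵥ c := by
    simp [sum_inner, real_inner_smul_left, dotProduct, mul_comm]
  have inner_site (i : ι) : ⟪v i, u - ∑ j, (K⁻¹ *ᵥ fun j => ⟪v j, u⟫) j • v j⟫ = 0 := by
    have h : K *ᵥ (K⁻¹ *ᵥ fun j => ⟪v j, u⟫) = fun j => ⟪v j, u⟫ := by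
      rw [mulVec_mulVec, mul_nonsing_inv _ hdet, one_mulVec]
    have hi := congrFun h i
    rw [inner_sub_right, ← hi, inner_sum, sub_eq_zero]
    simp [mulVec, dotProduct, real_inner_smul_right, hK, mul_comm]
  rw [inner_sub_right, real_inner_comm (∑ i, (K⁻¹ *ᵥ fun j => ⟪v j, w⟫) i • v i), inner_comb]
  simp only [inner_site]
  rw [inner_sub_left, inner_comb]
  simp [dotProduct]

/-- Power function bound for interpolation from the span of `v`. -/
theorem abs_inner_sub_gram_le {ι H : Type*} [Fintype ι] [DecidableEq ι] [NormedAddCommGroup H]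
    [InnerProductSpace ℝ H] (v : ι → H) {K : Matrix ι ι ℝ} (hK : ∀ i j, K i j = ⟪v i, v j⟫)
    (hdet : IsUnit K.det) (u w : H) :
    |⟪u, w⟫ - (fun i => ⟪v i, w⟫) ⬝ᵥ (K⁻¹ *ᵥ fun j => ⟪v j, u⟫)|
      ≤ √(⟪u, u⟫ - (fun i => ⟪v i, u⟫) ⬝ᵥ (K⁻¹ *ᵥ fun j => ⟪v j, u⟫))
        * √(⟪w, w⟫ - (fun i => ⟪v i, w⟫) ⬝ᵥ (K⁻¹ *ᵥ fun j => ⟪v j, w⟫)) := by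
  simp_rw [← inner_gram_residual v hK hdet]
  simp only [← norm_eq_sqrt_real_inner]
  exact abs_real_inner_le_norm _ _

theorem Matrix.inv_sub_inv_add_smul_one {ι : Type*} [Fintype ι] [DecidableEq ι]
    {K : Matrix ι ι ℝ} (hK : K.PosDef) {c : ℝ} (hc : 0 < c) :
    K⁻¹ - (K + c • (1 : Matrix ι ι ℝ))⁻¹ = (K + (1 / c) • (K * K))⁻¹ := by
  have hdet : IsUnit K.det := hK.det_pos.ne'.isUnit
  have hdet' : IsUnit (K + c • (1 : Matrix ι ι ℝ)).det :=
    (hK.add_posSemidef (PosSemidef.one.smul hc.le)).det_pos.ne'.isUnit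
  have hfac : K + (1 / c) • (K * K) = (1 / c) • ((K + c • (1 : Matrix ι ι ℝ)) * K) := by
    rw [add_mul, smul_add, smul_mul_assoc, one_mul, smul_smul, one_div_mul_cancel hc.ne',
      one_smul, add_comm]
  symm
  apply inv_eq_left_inv
  rw [hfac, mul_smul_comm, sub_mul, ← mul_assoc (K + c • (1 : Matrix ι ι ℝ))⁻¹,
    nonsing_inv_mul _ hdet', one_mul, add_mul, mul_add, nonsing_inv_mul_cancel_left _ _ hdet,
    smul_mul_assoc, one_mul, mul_smul_comm, nonsing_inv_mul _ hdet, add_sub_cancel_left, smul_smul,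
    one_div_mul_cancel hc.ne', one_smul]

theorem Matrix.IsHermitian.dotProduct_mulVec_comm {ι : Type*} [Fintype ι] {A : Matrix ι ι ℝ}
    (hA : A.IsHermitian) (a b : ι → ℝ) : a ⬝ᵥ (A *ᵥ b) = b ⬝ᵥ (A *ᵥ a) := by
  have hT : Aᵀ = A := by simpa using hA.eq
  rw [dotProduct_mulVec, ← mulVec_transpose, hT, dotProduct_comm]

/-- Deterministic finite-sample error bound for kernel ridge regression
(Theorem 1 of the paper): with ground-truth `f(z) = ⟪w, φ z⟫`, `‖w‖ ≤ Γ`,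
noisy targets `y_d = f(z_d) + δ_d` with `|δ_d| ≤ δ̄_d`, regularization `λ > 0`,
and KRR model `f̂(z) = K_{zZ}(K + DλI)⁻¹ y`, for every `z ∈ Z`:
`|f̂(z) − f(z)| ≤ P(z)√(Γ² + Δ − yᵀK⁻¹y) + δ̄ᵀ|K⁻¹K_{Zz}| + |yᵀ(K + (1/(Dλ))KK)⁻¹K_{Zz}|`,
where `Δ = max{ −εᵀK⁻¹ε + 2yᵀK⁻¹ε : |ε| ≤ δ̄ }`. -/
theorem krr_deterministic_error_bound
    {Z : Type*} [Nonempty Z] {H : Type*} [NormedAddCommGroup H]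
    [InnerProductSpace ℝ H] (φ : Z → H) {D : ℕ} (z : Fin D → Z)
    (k : Z → Z → ℝ) (hk : ∀ a b, k a b = ⟪φ a, φ b⟫)
    (K : Matrix (Fin D) (Fin D) ℝ) (hK : ∀ i j, K i j = k (z i) (z j))
    (hKpd : K.PosDef)
    (KZ : Z → Fin D → ℝ) (hKZ : ∀ x d, KZ x d = k (z d) x)
    (P : Z → ℝ) (hP : ∀ x, P x = Real.sqrt (k x x - KZ x ⬝ᵥ (K⁻¹ *ᵥ KZ x)))
    (Γ : ℝ) (w : H) (hw : ‖w‖ ≤ Γ)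
    (f : Z → ℝ) (hf : ∀ x, f x = ⟪w, φ x⟫)
    (δbar : Fin D → ℝ) (hδbar : ∀ d, 0 ≤ δbar d)
    (δ : Fin D → ℝ) (hδ : ∀ d, |δ d| ≤ δbar d)
    (y : Fin D → ℝ) (hy : ∀ d, y d = f (z d) + δ d)
    (lam : ℝ) (hlam : 0 < lam)
    (fhat : Z → ℝ)
    (hfhat : ∀ x, fhat x =
      KZ x ⬝ᵥ ((K + ((D : ℝ) * lam) • (1 : Matrix (Fin D) (Fin D) ℝ))⁻¹ *ᵥ y))
    (Δ : ℝ)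
    (hΔ : IsGreatest
      ((fun ε : Fin D → ℝ => -(ε ⬝ᵥ (K⁻¹ *ᵥ ε)) + 2 * (y ⬝ᵥ (K⁻¹ *ᵥ ε))) ''
        {ε : Fin D → ℝ | ∀ d, |ε d| ≤ δbar d}) Δ) :
    ∀ x : Z, |fhat x - f x| ≤
      P x * Real.sqrt (Γ ^ 2 + Δ - y ⬝ᵥ (K⁻¹ *ᵥ y))
      + δbar ⬝ᵥ (fun d => |(K⁻¹ *ᵥ KZ x) d|)
      + |y ⬝ᵥ ((K + (1 / ((D : ℝ) * lam)) • (K * K))⁻¹ *ᵥ KZ x)| := by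
  intro x
  have hdet : IsUnit K.det := hKpd.det_pos.ne'.isUnit
  have hsymm := hKpd.isHermitian.inv.dotProduct_mulVec_comm
  have hKgram (i j : Fin D) : K i j = ⟪φ (z i), φ (z j)⟫ := by rw [hK, hk]
  have hsite (u : Z) : (fun d => ⟪φ (z d), φ u⟫) = KZ u := by
    ext d
    rw [hKZ, hk]
  have htruth : (fun d => ⟪φ (z d), w⟫) = y - δ := by
    ext d
    rw [Pi.sub_apply, hy, hf, real_inner_comm, add_sub_cancel_right]
  have hinterp := abs_inner_sub_gram_le (fun d => φ (z d)) hKgram hdet (φ x) w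
  simp only [hsite, htruth] at hinterp
  rw [← hk, ← hP, real_inner_comm, ← hf] at hinterp
  have hΔδ : -(δ ⬝ᵥ (K⁻¹ *ᵥ δ)) + 2 * (y ⬝ᵥ (K⁻¹ *ᵥ δ)) ≤ Δ := hΔ.2 ⟨δ, hδ, rfl⟩
  have hnorm : ⟪w, w⟫ - (y - δ) ⬝ᵥ (K⁻¹ *ᵥ (y - δ)) ≤ Γ ^ 2 + Δ - y ⬝ᵥ (K⁻¹ *ᵥ y) := by
    have hw2 : ⟪w, w⟫ ≤ Γ ^ 2 := by
      rw [real_inner_self_eq_norm_sq]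
      gcongr
    simp only [mulVec_sub, sub_dotProduct, dotProduct_sub]
    linarith [hsymm δ y]
  have hbound : |f x - (y - δ) ⬝ᵥ (K⁻¹ *ᵥ KZ x)|
      ≤ P x * Real.sqrt (Γ ^ 2 + Δ - y ⬝ᵥ (K⁻¹ *ᵥ y)) := by
    refine hinterp.trans (mul_le_mul_of_nonneg_left (Real.sqrt_le_sqrt hnorm) ?_)
    rw [hP]
    exact Real.sqrt_nonneg _
  have hnoise : |δ ⬝ᵥ (K⁻¹ *ᵥ KZ x)| ≤ δbar ⬝ᵥ (fun d => |(K⁻¹ *ᵥ KZ x) d|) := by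
    refine (Finset.abs_sum_le_sum_abs _ _).trans (Finset.sum_le_sum fun d _ => ?_)
    rw [abs_mul]
    exact mul_le_mul_of_nonneg_right (hδ d) (abs_nonneg _)
  have hinv : K⁻¹ - (K + ((D : ℝ) * lam) • (1 : Matrix (Fin D) (Fin D) ℝ))⁻¹
      = (K + (1 / ((D : ℝ) * lam)) • (K * K))⁻¹ := by
    rcases Nat.eq_zero_or_pos D with rfl | hD
    · exact Subsingleton.elim _ _
    · exact inv_sub_inv_add_smul_one hKpd (mul_pos (Nat.cast_pos.mpr hD) hlam)
  have hreg : fhat x = y ⬝ᵥ (K⁻¹ *ᵥ KZ x)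
      - y ⬝ᵥ ((K + (1 / ((D : ℝ) * lam)) • (K * K))⁻¹ *ᵥ KZ x) := by
    have hherm : (K + ((D : ℝ) * lam) • (1 : Matrix (Fin D) (Fin D) ℝ)).IsHermitian :=
      hKpd.isHermitian.add (isHermitian_one.smul (IsSelfAdjoint.all _))
    rw [← hinv, sub_mulVec, dotProduct_sub, hfhat, hherm.inv.dotProduct_mulVec_comm,
      sub_sub_cancel]
  rw [sub_dotProduct] at hbound
  rw [hreg, abs_le]
  set r := y ⬝ᵥ ((K + (1 / ((D : ℝ) * lam)) • (K * K))⁻¹ *ᵥ KZ x)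
  constructor <;>
  linarith [(abs_le.mp hbound).1, (abs_le.mp hbound).2, (abs_le.mp hnoise).1,
    (abs_le.mp hnoise).2, neg_abs_le r, le_abs_self r]
end

section
/- Safety under the safe relaxation strategy (Proposition 2): let f : ℝ^{n_x} × ℝ^{n_u} → ℝ^{n_x} be the true dynamics, 𝕏 ⊆ ℝ^{n_x} a state-constraint set, 𝕏_safe ⊆ 𝕏 a safe set, and for each i ∈ {1, …, N} let 𝒳_i be a set-valued map assigning to a state and an i-tuple of inputs a subset of ℝ^{n_x}, satisfying the uniform containment property: for every state ξ ∈ ℝ^{n_x}, every i ∈ {1, …, N} and all inputs v₀, …, v_{i−1}, the i-step iterate of f from ξ under (v₀, …, v_{i−1}) belongs to 𝒳_i(ξ, v₀, …, v_{i−1}). Let x_{−N+1}, …, x_{−1}, x₀ be past closed-loop states and u_{−N+1}, …, u_{−1} past inputs with x_{−j+1} = f(x_{−j}, u_{−j}) for j = 1, …, N−1. Suppose the inputs u₀, …, u_{N−1} satisfy the relaxed constraints: for each t ∈ {1, …, N−1}, 𝒳_t(x₀, u₀, …, u_{t−1}) ∩ (⋂_{i=t+1}^{N} 𝒳_i(x_{t−i},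 u_{t−i}, …, u_{−1}, u₀, …, u_{t−1})) ⊆ 𝕏, and 𝒳_N(x₀, u₀, …, u_{N−1}) ⊆ 𝕏_safe. Then the true trajectory x_t = f(x_{t−1}, u_{t−1}), t = 1, …, N, starting from x₀ satisfies x_t ∈ 𝕏 for every t ∈ {1, …, N} and x_N ∈ 𝕏_safe. -/
/-- The `i`-step iterate of `f` from `ξ` under inputs `(v 0, …, v (i−1))`:
`ξ₀ = ξ` and `ξ_{j+1} = f(ξ_j, v_j)`. -/
def iterMap {X U : Type*} (f : X → U → X) : (i : ℕ) → X → (Fin i → U) → X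
  | 0, ξ, _ => ξ
  | i + 1, ξ, v => f (iterMap f i ξ (fun j => v j.castSucc)) (v (Fin.last i))

theorem iterMap_eq_of_trajectory {X U : Type*} {f : X → U → X} {z : ℕ → X} {w : ℕ → U} {i : ℕ}
    (h : ∀ j < i, z (j + 1) = f (z j) (w j)) :
    iterMap f i (z 0) (fun j : Fin i => w j) = z i := by
  induction i with
  | zero => rfl
  | succ i ih =>
    have hi := ih fun j hj => h j (by omega)
    simp only [iterMap, Fin.val_castSucc, Fin.val_last, hi, h i (by omega)]

theorem iterMap_add {X U : Type*} (f : X → U → X) (m n : ℕ) (ξ : X) (w : ℕ → U) :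
    iterMap f (m + n) ξ (fun j : Fin (m + n) => w j) =
      iterMap f n (iterMap f m ξ (fun j : Fin m => w j)) (fun j : Fin n => w (m + j)) := by
  induction n with
  | zero => rfl
  | succ n ih =>
    simp only [iterMap, Fin.val_castSucc, Fin.val_last]
    rw [← ih]
    rfl

/-- Safety under the safe relaxation strategy (Proposition 2): assuming the
uniform confidence-set containment property for `𝒳_1, …, 𝒳_N`, consistency of
the past closed-loop data, the relaxed state constraints for `t = 1, …, N−1`,
and the (non-relaxed) terminal constraint, the true trajectory from `x 0` under
`u 0, …, u (N−1)` stays in `𝕏` for `t = 1, …, N` and ends in `𝕏_safe`. -/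
theorem kpc_safe_relaxation_strategy
    {nx nu : ℕ} (f : (Fin nx → ℝ) → (Fin nu → ℝ) → (Fin nx → ℝ))
    (𝕏 𝕏safe : Set (Fin nx → ℝ)) (hsafe : 𝕏safe ⊆ 𝕏)
    (N : ℕ) (hN : 1 ≤ N)
    (𝒳 : (i : ℕ) → (Fin nx → ℝ) → (Fin i → (Fin nu → ℝ)) → Set (Fin nx → ℝ))
    (hcontain : ∀ ξ : Fin nx → ℝ, ∀ i : ℕ, 1 ≤ i → i ≤ N →
      ∀ v : Fin i → (Fin nu → ℝ), iterMap f i ξ v ∈ 𝒳 i ξ v)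
    (x : ℤ → Fin nx → ℝ) (u : ℤ → Fin nu → ℝ)
    (hpast : ∀ j : ℤ, 1 ≤ j → j ≤ (N : ℤ) - 1 → x (-j + 1) = f (x (-j)) (u (-j)))
    (hrelax : ∀ t : ℕ, 1 ≤ t → t ≤ N - 1 →
      𝒳 t (x 0) (fun j : Fin t => u (j : ℕ)) ∩
        (⋂ i ∈ Finset.Icc (t + 1) N,
          𝒳 i (x ((t : ℤ) - (i : ℤ)))
            (fun j : Fin i => u ((t : ℤ) - (i : ℤ) + (j : ℕ)))) ⊆ 𝕏)
    (hterm : 𝒳 N (x 0) (fun j : Fin N => u (j : ℕ)) ⊆ 𝕏safe) :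
    (∀ t : ℕ, 1 ≤ t → t ≤ N →
        iterMap f t (x 0) (fun j : Fin t => u (j : ℕ)) ∈ 𝕏) ∧
      iterMap f N (x 0) (fun j : Fin N => u (j : ℕ)) ∈ 𝕏safe := by
  have hN_safe : iterMap f N (x 0) (fun j : Fin N => u (j : ℕ)) ∈ 𝕏safe :=
    hterm (hcontain _ N hN le_rfl _)
  refine ⟨fun t ht htN => ?_, hN_safe⟩
  rcases htN.eq_or_lt with rfl | hlt
  · exact hsafe hN_safe
  refine hrelax t ht (by omega) ⟨hcontain _ t ht htN _, ?_⟩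
  simp only [Set.mem_iInter, Finset.mem_Icc]
  rintro i ⟨hti, hiN⟩
  obtain ⟨p, rfl⟩ : ∃ p, i = p + t := ⟨i - t, by omega⟩
  have hp : (t : ℤ) - ((p + t : ℕ) : ℤ) = -(p : ℤ) := by push_cast; ring
  have hpresent : iterMap f p (x (-(p : ℤ))) (fun j : Fin p => u (-(p : ℤ) + (j : ℕ))) = x 0 := by
    have h := iterMap_eq_of_trajectory (f := f) (i := p)
      (z := fun j : ℕ => x (-(p : ℤ) + j)) (w := fun j : ℕ => u (-(p : ℤ) + j)) (by
        intro j hj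
        have h := hpast (p - j) (by omega) (by omega)
        rw [show -((p : ℤ) - j) = -(p : ℤ) + j by ring] at h
        simpa only [Nat.cast_add, Nat.cast_one, add_assoc] using h)
    simpa using h
  have hsplit := iterMap_add f p t (x (-(p : ℤ))) (fun j : ℕ => u (-(p : ℤ) + j))
  rw [hpresent] at hsplit
  simp only [Nat.cast_add, neg_add_cancel_left] at hsplit
  rw [hp, ← hsplit]
  exact hcontain _ (p + t) (by omega) hiN _
end
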